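/- For every n ≥ 0, the map from the n-qubit real Clifford group C_n to the automorphism group of the n-qubit real Pauli group P_n that sends U to the automorphism P ↦ U P U⁻¹ is a surjective group homomorphism whose kernel is {I, −I}. -/

import Mathlib

open Matrix

noncomputable section

namespace RealStab

abbrev Mat (n : ℕ) := Matrix (Fin n → Fin 2) (Fin n → Fin 2) ℝ

/-- The real Pauli matrix `X`. -/
def X2 : Matrix (Fin 2) (Fin 2) ℝ := !![0, 1; 1, 0]

/-- The real Pauli matrix `Z`. -/
def Z2 : Matrix (Fin 2) (Fin 2) ℝ := !![1, 0; 0, -1]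

/-- The set `{I, X, Z, XZ}` of single-qubit Pauli matrices. -/
def pauliSet : Set (Matrix (Fin 2) (Fin 2) ℝ) := {1, X2, Z2, X2 * Z2}

/-- The `n`-fold Kronecker (tensor) product `P 0 ⊗ ⋯ ⊗ P (n-1)`, represented as a
matrix indexed by functions `Fin n → Fin 2` (a `2^n × 2^n` matrix). -/
def tensorN {n : ℕ} (P : Fin n → Matrix (Fin 2) (Fin 2) ℝ) : Mat n :=
  Matrix.of fun x y => ∏ i, P i (x i) (y i)

/-- The `n`-qubit real Pauli group `P_n`, as a set of `2^n × 2^n` real matrices. -/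
def PauliGroup (n : ℕ) : Set (Mat n) :=
  { M | ∃ a : Fin 2, ∃ P : Fin n → Matrix (Fin 2) (Fin 2) ℝ,
      (∀ i, P i ∈ pauliSet) ∧ M = (-1 : ℝ) ^ (a : ℕ) • tensorN P }


/-- The `n`-qubit real Clifford group `C_n`: orthogonal matrices normalizing `P_n`. -/
def CliffordGroup (n : ℕ) : Set (Mat n) :=
  { U | U ∈ Matrix.orthogonalGroup (Fin n → Fin 2) ℝ ∧
        ∀ P ∈ PauliGroup n, U * P * U⁻¹ ∈ PauliGroup n }

/-- The `n`-qubit real Pauli group as a subgroup of the units of the matrix ring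
(the subgroup generated by — equivalently, consisting of — the Pauli matrices). -/
def PauliUnits (n : ℕ) : Subgroup (Mat n)ˣ :=
  Subgroup.closure { U : (Mat n)ˣ | (U : Mat n) ∈ PauliGroup n }

/-- The `n`-qubit real Clifford group as a subgroup of the units of the matrix ring
(the subgroup generated by — equivalently, consisting of — the Clifford matrices). -/
def CliffordUnits (n : ℕ) : Subgroup (Mat n)ˣ :=
  Subgroup.closure { U : (Mat n)ˣ | (U : Mat n) ∈ CliffordGroup n }

variable {n : ℕ}

lemma tensorN_mul (P Q : Fin n → Matrix (Fin 2) (Fin 2) ℝ) :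
    tensorN P * tensorN Q = tensorN fun i => P i * Q i := by
  ext x y
  simp only [tensorN, Matrix.mul_apply, Matrix.of_apply, ← Finset.prod_mul_distrib,
    Finset.prod_univ_sum, Fintype.piFinset_univ]

lemma tensorN_transpose (P : Fin n → Matrix (Fin 2) (Fin 2) ℝ) :
    (tensorN P)ᵀ = tensorN fun i => (P i)ᵀ := rfl

lemma tensorN_one : tensorN (fun _ : Fin n => (1 : Matrix (Fin 2) (Fin 2) ℝ)) = 1 := by
  ext x y
  simp [tensorN, Matrix.one_apply, Finset.prod_boole, funext_iff]

lemma trace_tensorN (P : Fin n → Matrix (Fin 2) (Fin 2) ℝ) :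
    (tensorN P).trace = ∏ i, (P i).trace := by
  simp only [tensorN, Matrix.trace, Matrix.diag_apply, Matrix.of_apply,
    Finset.prod_univ_sum, Fintype.piFinset_univ]

lemma tensorN_smul (s : Fin n → ℝ) (P : Fin n → Matrix (Fin 2) (Fin 2) ℝ) :
    tensorN (fun i => s i • P i) = (∏ i, s i) • tensorN P := by
  ext x y
  simp [tensorN, Finset.prod_mul_distrib]

lemma mem_pauliGroup_iff {M : Mat n} :
    M ∈ PauliGroup n ↔ ∃ P : Fin n → Matrix (Fin 2) (Fin 2) ℝ,
      (∀ i, P i ∈ pauliSet) ∧ (M = tensorN P ∨ M = -tensorN P) := by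
  simp only [PauliGroup, Set.mem_ofPred_eq, Fin.exists_fin_two, ← exists_or]
  simp [and_or_left]

lemma neg_mem_pauliGroup {M : Mat n} (hM : M ∈ PauliGroup n) : -M ∈ PauliGroup n := by
  obtain ⟨P, hP, h⟩ := mem_pauliGroup_iff.1 hM
  refine mem_pauliGroup_iff.2 ⟨P, hP, ?_⟩
  rcases h with rfl | rfl <;> simp

lemma tensorN_mem_pauliGroup {P : Fin n → Matrix (Fin 2) (Fin 2) ℝ}
    (hP : ∀ i, P i ∈ pauliSet ∨ -P i ∈ pauliSet) : tensorN P ∈ PauliGroup n := by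
  have h : ∀ i, ∃ (s : ℝ) (C : Matrix (Fin 2) (Fin 2) ℝ),
      (s = 1 ∨ s = -1) ∧ C ∈ pauliSet ∧ P i = s • C := fun i => by
    rcases hP i with h | h
    · exact ⟨1, P i, Or.inl rfl, h, by simp⟩
    · exact ⟨-1, -P i, Or.inr rfl, h, by simp⟩
  choose s C hs hC hPC using h
  have hprod : (∏ i, s i) = 1 ∨ (∏ i, s i) = -1 :=
    Finset.prod_induction s (fun r => r = 1 ∨ r = -1)
      (by rintro a b (rfl | rfl) (rfl | rfl) <;> simp) (Or.inl rfl) fun i _ => hs i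
  rw [funext hPC, tensorN_smul]
  refine mem_pauliGroup_iff.2 ⟨C, hC, ?_⟩
  rcases hprod with h | h <;> simp [h]

lemma one_mem_pauliGroup : (1 : Mat n) ∈ PauliGroup n := by
  rw [← tensorN_one]
  exact tensorN_mem_pauliGroup fun _ => by simp [pauliSet]

lemma pauliSet_mul {A B : Matrix (Fin 2) (Fin 2) ℝ} (hA : A ∈ pauliSet) (hB : B ∈ pauliSet) :
    A * B ∈ pauliSet ∨ -(A * B) ∈ pauliSet := by
  simp only [pauliSet, Set.mem_insert_iff, Set.mem_singleton_iff] at *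
  rcases hA with rfl | rfl | rfl | rfl <;> rcases hB with rfl | rfl | rfl | rfl <;>
    simp [X2, Z2, Matrix.one_fin_two]

lemma pauliSet_transpose {A : Matrix (Fin 2) (Fin 2) ℝ} (hA : A ∈ pauliSet) :
    Aᵀ ∈ pauliSet ∨ -Aᵀ ∈ pauliSet := by
  simp only [pauliSet, Set.mem_insert_iff, Set.mem_singleton_iff] at *
  rcases hA with rfl | rfl | rfl | rfl <;>
    simp [X2, Z2, Matrix.one_fin_two, ← Matrix.ext_iff, Fin.forall_fin_two]

lemma pauliSet_mul_transpose {A : Matrix (Fin 2) (Fin 2) ℝ} (hA : A ∈ pauliSet) :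
    A * Aᵀ = 1 := by
  simp only [pauliSet, Set.mem_insert_iff, Set.mem_singleton_iff] at hA
  rcases hA with rfl | rfl | rfl | rfl <;>
    simp [X2, Z2, ← Matrix.ext_iff, Fin.forall_fin_two, Matrix.vecMul, dotProduct]

lemma pauliSet_eq_one_of_trace_ne_zero {A : Matrix (Fin 2) (Fin 2) ℝ} (hA : A ∈ pauliSet)
    (h : A.trace ≠ 0) : A = 1 := by
  simp only [pauliSet, Set.mem_insert_iff, Set.mem_singleton_iff] at hA
  rcases hA with rfl | rfl | rfl | rfl <;>
    simp [X2, Z2, Matrix.trace_fin_two] at h ⊢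

lemma mul_mem_pauliGroup {M N : Mat n} (hM : M ∈ PauliGroup n) (hN : N ∈ PauliGroup n) :
    M * N ∈ PauliGroup n := by
  obtain ⟨P, hP, hM⟩ := mem_pauliGroup_iff.1 hM
  obtain ⟨Q, hQ, hN⟩ := mem_pauliGroup_iff.1 hN
  have h : tensorN P * tensorN Q ∈ PauliGroup n := by
    rw [tensorN_mul]
    exact tensorN_mem_pauliGroup fun i => pauliSet_mul (hP i) (hQ i)
  rcases hM with rfl | rfl <;> rcases hN with rfl | rfl <;>
    simp [h, neg_mem_pauliGroup h]

lemma transpose_mem_pauliGroup {M : Mat n} (hM : M ∈ PauliGroup n) : Mᵀ ∈ PauliGroup n := by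
  obtain ⟨P, hP, hM⟩ := mem_pauliGroup_iff.1 hM
  have h : (tensorN P)ᵀ ∈ PauliGroup n :=
    tensorN_mem_pauliGroup fun i => pauliSet_transpose (hP i)
  rcases hM with rfl | rfl <;> simp [h, neg_mem_pauliGroup h]

lemma mul_transpose_of_mem_pauliGroup {M : Mat n} (hM : M ∈ PauliGroup n) : M * Mᵀ = 1 := by
  obtain ⟨P, hP, hM⟩ := mem_pauliGroup_iff.1 hM
  have h : tensorN P * (tensorN P)ᵀ = 1 := by
    rw [tensorN_transpose, tensorN_mul, ← tensorN_one]
    exact congrArg tensorN (funext fun i => pauliSet_mul_transpose (hP i))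
  rcases hM with rfl | rfl <;> simp [h]

lemma eq_one_or_neg_one_of_trace_ne_zero {M : Mat n} (hM : M ∈ PauliGroup n)
    (h : M.trace ≠ 0) : M = 1 ∨ M = -1 := by
  obtain ⟨P, hP, hM⟩ := mem_pauliGroup_iff.1 hM
  have ht : (tensorN P).trace ≠ 0 := by
    rcases hM with rfl | rfl
    · exact h
    · simpa using h
  rw [trace_tensorN] at ht
  have h1 : P = fun _ => 1 := funext fun i =>
    pauliSet_eq_one_of_trace_ne_zero (hP i) (Finset.prod_ne_zero_iff.1 ht i (Finset.mem_univ i))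
  rwa [h1, tensorN_one] at hM

lemma finite_pauliGroup : (PauliGroup n).Finite := by
  have hfin : (Set.univ.pi fun _ : Fin n => pauliSet).Finite :=
    Set.Finite.pi fun _ => by simp [pauliSet]
  refine ((hfin.image tensorN).union (hfin.image fun P => -tensorN P)).subset fun M hM => ?_
  obtain ⟨P, hP, rfl | rfl⟩ := mem_pauliGroup_iff.1 hM
  · exact Or.inl ⟨P, fun i _ => hP i, rfl⟩
  · exact Or.inr ⟨P, fun i _ => hP i, rfl⟩

/-- A matrix commuting with every Pauli matrix is scalar. -/
lemma eq_smul_one_of_commute_pauliGroup {M : Mat n}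
    (h : ∀ P ∈ PauliGroup n, M * P = P * M) : M = M 0 0 • 1 := by
  have hoff : ∀ x y, x ≠ y → M x y = 0 := fun x y hxy => by
    obtain ⟨i, hi⟩ := Function.ne_iff.1 hxy
    have hZ : tensorN (fun j => if j = i then Z2 else 1) =
        Matrix.diagonal fun y : Fin n → Fin 2 => Z2 (y i) (y i) := by
      ext u v
      by_cases huv : u = v
      · subst huv
        rw [Matrix.diagonal_apply_eq, tensorN, Matrix.of_apply, Finset.prod_eq_single i]
        · simp
        · intro j _ hj
          simp [hj]
        · simp
      · rw [Matrix.diagonal_apply_ne _ huv, tensorN, Matrix.of_apply]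
        obtain ⟨j, hj⟩ := Function.ne_iff.1 huv
        refine Finset.prod_eq_zero (Finset.mem_univ j) ?_
        split_ifs
        · revert hj
          generalize u j = a
          generalize v j = b
          fin_cases a <;> fin_cases b <;> simp [Z2]
        · exact Matrix.one_apply_ne hj
    have hc := h _ (tensorN_mem_pauliGroup (P := fun j => if j = i then Z2 else 1) fun j => by
      by_cases hj : j = i <;> simp [hj, pauliSet])
    rw [hZ] at hc
    have hc := congrFun (congrFun hc x) y
    rw [Matrix.mul_diagonal, Matrix.diagonal_mul] at hc
    revert hc hi
    generalize x i = a
    generalize y i = b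
    fin_cases a <;> fin_cases b <;> simp [Z2] <;> intro _ <;> linarith
  have hdiag : ∀ x, M x x = M 0 0 := fun x => by
    have hX : ∀ u v, tensorN (fun j => if x j = 0 then 1 else X2) u v =
        if u = v + x then 1 else 0 := fun u v => by
      have : ∀ a b c : Fin 2, (if c = 0 then 1 else X2) a b = if a = b + c then (1 : ℝ) else 0 := by
        intro a b c
        fin_cases a <;> fin_cases b <;> fin_cases c <;> simp [X2]
      simp [tensorN, this, Finset.prod_boole, funext_iff]
    have hc := h _ (tensorN_mem_pauliGroup (P := fun j => if x j = 0 then 1 else X2) fun j => by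
      by_cases hj : x j = 0 <;> simp [hj, pauliSet])
    have hc := congrFun (congrFun hc x) 0
    simpa [Matrix.mul_apply, hX] using hc
  ext x y
  by_cases hxy : x = y
  · subst hxy
    simp [hdiag x]
  · simp [hoff x y hxy, hxy]

lemma mem_pauliUnits_iff {U : (Mat n)ˣ} : U ∈ PauliUnits n ↔ (U : Mat n) ∈ PauliGroup n := by
  refine ⟨fun hU => ?_, fun hU => Subgroup.subset_closure hU⟩
  induction hU using Subgroup.closure_induction with
  | mem U hU => exact hU
  | one => exact one_mem_pauliGroup
  | mul U V _ _ hU hV => exact mul_mem_pauliGroup hU hV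
  | inv U _ hU =>
    rw [left_inv_eq_right_inv U.inv_mul (mul_transpose_of_mem_pauliGroup hU)]
    exact transpose_mem_pauliGroup hU

instance : Finite (PauliUnits n) :=
  have := (finite_pauliGroup (n := n)).to_subtype
  Finite.of_injective (β := PauliGroup n)
    (fun P => ⟨((P : (Mat n)ˣ) : Mat n), mem_pauliUnits_iff.1 P.2⟩)
    fun _ _ h => Subtype.ext (Units.ext (congrArg Subtype.val h))

lemma coe_inv_of_mem_pauliUnits {U : (Mat n)ˣ} (hU : U ∈ PauliUnits n) :
    ((U⁻¹ : (Mat n)ˣ) : Mat n) = (U : Mat n)ᵀ :=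
  left_inv_eq_right_inv U.inv_mul (mul_transpose_of_mem_pauliGroup (mem_pauliUnits_iff.1 hU))

lemma exists_unit_of_mem_pauliGroup {M : Mat n} (hM : M ∈ PauliGroup n) :
    ∃ P : PauliUnits n, ((P : (Mat n)ˣ) : Mat n) = M :=
  ⟨⟨⟨M, Mᵀ, mul_transpose_of_mem_pauliGroup hM,
    mul_eq_one_comm.1 (mul_transpose_of_mem_pauliGroup hM)⟩, mem_pauliUnits_iff.2 hM⟩, rfl⟩

lemma coe_inv_of_mem_cliffordUnits {U : (Mat n)ˣ} (hU : U ∈ CliffordUnits n) :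
    ((U⁻¹ : (Mat n)ˣ) : Mat n) = (U : Mat n)ᵀ := by
  induction hU using Subgroup.closure_induction with
  | mem U hU =>
    exact left_inv_eq_right_inv U.inv_mul ((Matrix.mem_orthogonalGroup_iff _ _).1 hU.1)
  | one => simp
  | mul U V _ _ hU hV => simp [hU, hV]
  | inv U _ hU => rw [hU, inv_inv, Matrix.transpose_transpose]

lemma cliffordUnits_le_normalizer :
    CliffordUnits n ≤ Subgroup.normalizer (PauliUnits n : Set (Mat n)ˣ) := by
  refine (Subgroup.closure_le _).2 fun U hU => ?_
  have : Finite (PauliUnits n : Set (Mat n)ˣ) := inferInstanceAs (Finite (PauliUnits n))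
  refine Subgroup.mem_normalizer_fintype fun P hP => mem_pauliUnits_iff.2 ?_
  have h := hU.2 _ (mem_pauliUnits_iff.1 hP)
  rwa [← Matrix.coe_units_inv] at h

/-- An automorphism of the Pauli group fixes `-1`. -/
lemma mulAut_apply_of_coe_eq_neg_one (φ : MulAut (PauliUnits n)) {P : PauliUnits n}
    (hP : ((P : (Mat n)ˣ) : Mat n) = -1) : (((φ P : PauliUnits n) : (Mat n)ˣ) : Mat n) = -1 := by
  have hcomm : ∀ Q, φ P * Q = Q * φ P := fun Q => by
    obtain ⟨R, rfl⟩ := φ.surjective Q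
    rw [← map_mul, ← map_mul]
    congr 1
    ext1
    ext1
    simp [hP]
  have hs := eq_smul_one_of_commute_pauliGroup
    (M := (((φ P : PauliUnits n) : (Mat n)ˣ) : Mat n)) fun M hM => by
      obtain ⟨Q, rfl⟩ := exists_unit_of_mem_pauliGroup hM
      exact congrArg (fun R : PauliUnits n => ((R : (Mat n)ˣ) : Mat n)) (hcomm Q)
  have hmem := mem_pauliUnits_iff.1 (φ P).2
  have hne : (((φ P : PauliUnits n) : (Mat n)ˣ) : Mat n).trace ≠ 0 := fun h0 => by
    rw [hs, Matrix.trace_smul, Matrix.trace_one, smul_eq_mul, mul_eq_zero] at h0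
    rcases h0 with h0 | h0
    · rw [h0, zero_smul] at hs
      exact (φ P : (Mat n)ˣ).ne_zero hs
    · simp at h0
  rcases eq_one_or_neg_one_of_trace_ne_zero hmem hne with h | h
  · have h1 : P = 1 := by
      rw [← map_eq_one_iff φ φ.injective]
      exact Subtype.ext (Units.ext h)
    rwa [h1, map_one, ← h1]
  · exact h

/-- The average intertwining the defining representation of the Pauli group with its twist
by an automorphism. -/
lemma exists_ne_zero_intertwiner (φ : MulAut (PauliUnits n)) :
    ∃ T : Mat n, T ≠ 0 ∧ ∀ P : PauliUnits n,
      T * ((P : (Mat n)ˣ) : Mat n) = (((φ P : PauliUnits n) : (Mat n)ˣ) : Mat n) * T := by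
  have := Fintype.ofFinite (PauliUnits n)
  let c : PauliUnits n →* Mat n := (Units.coeHom _).comp (PauliUnits n).subtype
  let T : Mat n → Mat n := fun A => ∑ P, c (φ P) * A * c P⁻¹
  have hT : ∀ A P, T A * c P = c (φ P) * T A := fun A P => by
    simp only [T, Finset.sum_mul, Finset.mul_sum]
    rw [← Equiv.sum_comp (Equiv.mulLeft P)]
    refine Finset.sum_congr rfl fun Q _ => ?_
    simp only [Equiv.coe_mulLeft, mul_assoc, ← map_mul, _root_.mul_inv_rev]
    simp [mul_assoc]
  suffices h : ∃ A, T A ≠ 0 by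
    obtain ⟨A, hA⟩ := h
    exact ⟨T A, hA, hT A⟩
  by_contra! h
  have hentry : ∀ i j, ∑ P, c (φ P) i i * c P⁻¹ j j = 0 := fun i j => by
    have := congrFun (congrFun (h (Matrix.single i j 1)) i) j
    simpa [T, Matrix.sum_apply, Matrix.mul_apply, Matrix.single_apply, ite_and] using this
  have hsum : ∑ P, (c (φ P)).trace * (c P⁻¹).trace = 0 := by
    simp only [Matrix.trace, Matrix.diag_apply, Finset.sum_mul_sum]
    rw [Finset.sum_comm]
    refine Finset.sum_eq_zero fun i _ => ?_
    rw [Finset.sum_comm]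
    exact Finset.sum_eq_zero fun j _ => hentry i j
  have hnonneg : ∀ P, 0 ≤ (c (φ P)).trace * (c P⁻¹).trace := fun P => by
    by_cases hP : (c P⁻¹).trace = 0
    · simp [hP]
    rcases eq_one_or_neg_one_of_trace_ne_zero (mem_pauliUnits_iff.1 (P⁻¹).2) hP with h1 | h1
    · have hP1 : P = 1 := inv_eq_one.1 (Subtype.ext (Units.ext h1))
      simp only [hP1, map_one, inv_one]
      exact mul_self_nonneg _
    · have hφ : c (φ P⁻¹) = -1 := mulAut_apply_of_coe_eq_neg_one φ h1
      have hφ' : c (φ P) = -1 := by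
        have h2 : c (φ P⁻¹) * c (φ P) = 1 := by rw [← map_mul, ← map_mul]; simp
        rw [hφ, neg_one_mul] at h2
        rw [← h2, neg_neg]
      have h1 : c P⁻¹ = -1 := h1
      rw [hφ', h1]
      exact mul_self_nonneg _
  have h1 := (Finset.sum_eq_zero_iff_of_nonneg fun P _ => hnonneg P).1 hsum 1 (Finset.mem_univ _)
  simp at h1

/-- Every automorphism of the Pauli group is conjugation by an orthogonal matrix. -/
lemma exists_orthogonal_intertwiner (φ : MulAut (PauliUnits n)) :
    ∃ V : Mat n, V * Vᵀ = 1 ∧ ∀ P : PauliUnits n,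
      V * ((P : (Mat n)ˣ) : Mat n) = (((φ P : PauliUnits n) : (Mat n)ˣ) : Mat n) * V := by
  obtain ⟨T, hT0, hT⟩ := exists_ne_zero_intertwiner φ
  have hTt : ∀ P : PauliUnits n,
      Tᵀ * (((φ P : PauliUnits n) : (Mat n)ˣ) : Mat n) = ((P : (Mat n)ˣ) : Mat n) * Tᵀ := by
    intro P
    have h := congrArg Matrix.transpose (hT P⁻¹)
    rw [map_inv, Subgroup.coe_inv, Subgroup.coe_inv, coe_inv_of_mem_pauliUnits P.2,
      coe_inv_of_mem_pauliUnits (φ P).2] at h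
    simpa only [Matrix.transpose_mul, Matrix.transpose_transpose] using h.symm
  have hs := eq_smul_one_of_commute_pauliGroup (M := Tᵀ * T) fun M hM => by
    obtain ⟨P, rfl⟩ := exists_unit_of_mem_pauliGroup hM
    rw [mul_assoc, hT, ← mul_assoc, hTt, mul_assoc]
  set r := (Tᵀ * T) 0 0 with hr
  have hr0 : r ≠ 0 := fun h => hT0 <| by
    rw [h, zero_smul] at hs
    rw [← Matrix.conjTranspose_mul_self_eq_zero (A := T)]
    simpa using hs
  have hrpos : 0 < r := lt_of_le_of_ne
    (by rw [hr, Matrix.mul_apply]; exact Finset.sum_nonneg fun x _ => mul_self_nonneg (T x 0))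
    hr0.symm
  refine ⟨(√r)⁻¹ • T, mul_eq_one_comm.1 ?_, fun P => ?_⟩
  · rw [Matrix.transpose_smul, Matrix.smul_mul, Matrix.mul_smul, hs, smul_smul, smul_smul,
      ← mul_inv, Real.mul_self_sqrt hrpos.le, inv_mul_cancel₀ hr0, one_smul]
  · rw [Matrix.smul_mul, Matrix.mul_smul, hT]

/-- The map `C_n → Aut(P_n)` sending `U` to conjugation `P ↦ U P U⁻¹`
is a surjective group homomorphism with kernel `{I, −I}`. -/
theorem clifford_to_aut_surjective_kernel (n : ℕ) :
    ∃ f : ↥(CliffordUnits n) →* MulAut ↥(PauliUnits n),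
      (∀ (U : ↥(CliffordUnits n)) (P : ↥(PauliUnits n)),
        ((f U P : (Mat n)ˣ) : Mat n) =
          ((U : (Mat n)ˣ) : Mat n) * ((P : (Mat n)ˣ) : Mat n) *
            ((U⁻¹ : (Mat n)ˣ) : Mat n)) ∧
      Function.Surjective f ∧
      (∀ U : ↥(CliffordUnits n),
        f U = 1 ↔ ((U : (Mat n)ˣ) : Mat n) = 1 ∨ ((U : (Mat n)ˣ) : Mat n) = -1) := by
  refine ⟨(PauliUnits n).normalizerMonoidHom.comp
    (Subgroup.inclusion cliffordUnits_le_normalizer), fun U P => rfl, fun φ => ?_, fun U => ?_⟩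
  · obtain ⟨V, hV, hφ⟩ := exists_orthogonal_intertwiner φ
    let W : (Mat n)ˣ := ⟨V, Vᵀ, hV, mul_eq_one_comm.1 hV⟩
    have hconj : ∀ P : PauliUnits n, W * P * W⁻¹ = φ P := fun P =>
      mul_inv_eq_of_eq_mul (Units.ext (hφ P))
    have hW : W ∈ CliffordUnits n := Subgroup.subset_closure
      ⟨(Matrix.mem_orthogonalGroup_iff _ _).2 hV, fun M hM => by
        obtain ⟨P, rfl⟩ := exists_unit_of_mem_pauliGroup hM
        rw [← Matrix.coe_units_inv, ← Units.val_mul, ← Units.val_mul, hconj]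
        exact mem_pauliUnits_iff.1 (φ P).2⟩
    exact ⟨⟨W, hW⟩, MulEquiv.ext fun P => Subtype.ext (hconj P)⟩
  · have hker : (PauliUnits n).normalizerMonoidHom.comp
        (Subgroup.inclusion cliffordUnits_le_normalizer) U = 1 ↔
        ∀ P : PauliUnits n, (U : (Mat n)ˣ) * P * (U : (Mat n)ˣ)⁻¹ = P := by
      rw [MulEquiv.ext_iff]
      exact forall_congr' fun P => Subtype.ext_iff
    rw [hker]
    refine ⟨fun h => ?_, fun h P => ?_⟩
    · have hs := eq_smul_one_of_commute_pauliGroup (M := ((U : (Mat n)ˣ) : Mat n))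
        fun M hM => by
          obtain ⟨P, rfl⟩ := exists_unit_of_mem_pauliGroup hM
          exact congrArg Units.val (mul_inv_eq_iff_eq_mul.1 (h P))
      have hU := (U : (Mat n)ˣ).mul_inv
      rw [coe_inv_of_mem_cliffordUnits U.2] at hU
      generalize ((U : (Mat n)ˣ) : Mat n) 0 0 = r at hs
      rw [hs] at hU ⊢
      have hr := congrFun (congrFun hU 0) 0
      simp only [Matrix.transpose_smul, Matrix.transpose_one, Matrix.mul_smul, mul_one,
        Matrix.smul_apply, Matrix.one_apply_eq, smul_eq_mul] at hr
      rcases mul_self_eq_one_iff.1 hr with rfl | rfl <;> simp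
    · rw [mul_inv_eq_iff_eq_mul]
      ext1
      rcases h with h | h <;> simp [h]

end RealStab

end
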